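/- arXiv:2409.17305 — 2 statements merged into one kernel-verified Lean document; each statement's English description precedes it below -/
import Mathlib

section
/- Let η ≠ 0, ℓ > −3/2 with ℓ ≠ −1, and H ∈ ℝ. Then for each x ∈ ℝ, (2x)^{n+1} D_{n,ℓ,η}(H; 1/(2x)) → x φ′_{ℓ,η}(x) + H φ_{ℓ,η}(x) as n → ∞ (interpreting the left-hand side as the polynomial in x obtained by clearing denominators, whose value at x = 0 is H). Moreover, the convergence is uniform on every compact subset of ℝ. -/
open Polynomial

/-- The recurrence coefficient α_n = −η/(2(ℓ+n+1)(ℓ+n+2)). -/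
noncomputable def alphaR (l η : ℝ) (n : ℕ) : ℝ :=
  -η / (2 * (l + n + 1) * (l + n + 2))

/-- The recurrence coefficient
β_n = ((ℓ+n+1)² + η²)/(2(2ℓ+2n+1)(2ℓ+2n+2)(2ℓ+2n+3)(ℓ+n+1)). -/
noncomputable def betaR (l η : ℝ) (n : ℕ) : ℝ :=
  ((l + n + 1) ^ 2 + η ^ 2) /
    (2 * (2 * l + 2 * n + 1) * (2 * l + 2 * n + 2) * (2 * l + 2 * n + 3) * (l + n + 1))

/-- The monic orthogonal polynomials R_{n,ℓ,η} of Wimp, defined by the three-term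
recurrence R_{n+1} = (X − α_n) R_n − β_n R_{n−1}, with R_0 = 1 and
R_1 = X + η/(2(ℓ+1)(ℓ+2)). -/
noncomputable def Rpoly (l η : ℝ) : ℕ → Polynomial ℝ
  | 0 => 1
  | 1 => X + C (η / (2 * (l + 1) * (l + 2)))
  | (n + 2) =>
      (X - C (alphaR l η (n + 1))) * Rpoly l η (n + 1) - C (betaR l η (n + 1)) * Rpoly l η n

/-- The polynomial D_{n,ℓ,η}(H; ·) = (η/(2(ℓ+1)) + H X) R_{n,ℓ,η}
− ((1 + η²/(ℓ+1)²)/(4(2ℓ+3))) R_{n−1,ℓ+1,η} (for n ≥ 1). -/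
noncomputable def Dpoly (l η H : ℝ) (n : ℕ) : Polynomial ℝ :=
  (C (η / (2 * (l + 1))) + C H * X) * Rpoly l η n -
    C ((1 + η ^ 2 / (l + 1) ^ 2) / (4 * (2 * l + 3))) * Rpoly (l + 1) η (n - 1)

noncomputable def coulombCoeff (l η : ℝ) : ℕ → ℝ
  | 0 => 1
  | 1 => η / (l + 1)
  | (k + 2) =>
      (2 * η * coulombCoeff l η (k + 1) - coulombCoeff l η k) /
        (((k : ℝ) + 2) * (((k : ℝ) + 2) + 2 * l + 1))

/-- The function φ_{ℓ,η}, real-valued on ℝ. -/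
noncomputable def coulombPhi (l η x : ℝ) : ℝ := ∑' k : ℕ, coulombCoeff l η k * x ^ k

/-- The reversed polynomial (2x)^{n+1} D_{n,ℓ,η}(H; 1/(2x)), interpreted as the
polynomial in x obtained by clearing denominators, namely x ↦ (reflect (n+1) D_{n,ℓ,η}(H;·))(2x). -/
noncomputable def reversedD (l η H : ℝ) (n : ℕ) (x : ℝ) : ℝ :=
  eval (2 * x) (reflect (n + 1) (Dpoly l η H n))

lemma coulombCoeff_add_two_mul {l : ℝ} (η : ℝ) (hl : -3/2 < l) (k : ℕ) :
    ((k : ℝ) + 2) * (k + 2 * l + 3) * coulombCoeff l η (k + 2) =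
      2 * η * coulombCoeff l η (k + 1) - coulombCoeff l η k := by
  have h1 : (k : ℝ) + 2 ≠ 0 := by positivity
  have h2 : (k : ℝ) + 2 * l + 3 ≠ 0 := by
    have : (0 : ℝ) ≤ k := k.cast_nonneg
    linarith
  rw [coulombCoeff, show (k : ℝ) + 2 + 2 * l + 1 = k + 2 * l + 3 by ring]
  field_simp

/-- Coefficient form of `φ_l' = η/(l+1) φ_l - (1 + η²/(l+1)²)/(2l+3) x φ_{l+1}`. -/
lemma coulombCoeff_raise {l : ℝ} (η : ℝ) (hl : -3/2 < l) (hl1 : l ≠ -1) (k : ℕ) :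
    ((k : ℝ) + 2) * coulombCoeff l η (k + 2) = η / (l + 1) * coulombCoeff l η (k + 1) -
      (1 + η ^ 2 / (l + 1) ^ 2) / (2 * l + 3) * coulombCoeff (l + 1) η k := by
  have h1 : l + 1 ≠ 0 := fun h => hl1 (by linarith)
  have h2 : l + 2 ≠ 0 := by linarith
  have h3 : 2 * l + 3 ≠ 0 := by linarith
  have h4 : 2 * l + 4 ≠ 0 := by linarith
  induction k using Nat.twoStepInduction with
  | zero =>
    simp only [Nat.cast_zero, coulombCoeff, zero_add, show 2 + 2 * l + 1 = 2 * l + 3 by ring]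
    generalize hp : 2 * l + 3 = p at *
    field_simp
    rw [← hp]
    ring
  | one =>
    have e0 := coulombCoeff_add_two_mul η hl 0
    have e1 := coulombCoeff_add_two_mul η hl 1
    have e : coulombCoeff l η 1 = η / (l + 1) := rfl
    have f : coulombCoeff (l + 1) η 1 = η / (l + 2) := by
      rw [coulombCoeff]; ring
    have g : coulombCoeff l η 0 = 1 := rfl
    simp only [Nat.cast_zero, Nat.cast_one, zero_add, f, e, g] at e0 e1 ⊢
    norm_num at e0 e1 ⊢
    have e0' : coulombCoeff l η 2 = (2 * η * (η / (l + 1)) - 1) / (2 * (2 * l + 3)) := by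
      rw [eq_div_iff (by positivity), ← e0]; ring
    have e1' : 3 * coulombCoeff l η 3 =
        (2 * η * coulombCoeff l η 2 - η / (l + 1)) / (2 * l + 4) := by
      rw [eq_div_iff h4, ← e1]; ring
    rw [e1', e0', show 2 * l + 4 = 2 * (l + 2) by ring]
    field_simp
    ring
  | more k ih0 ih1 =>
    have hk : (0 : ℝ) ≤ k := k.cast_nonneg
    have p : (0 : ℝ) < ((k : ℝ) + 2) * (k + 2 * (l + 1) + 3) := by
      apply mul_pos <;> linarith
    have e1 := coulombCoeff_add_two_mul η hl (k + 1)
    have e2 := coulombCoeff_add_two_mul η hl (k + 2)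
    have e3 := coulombCoeff_add_two_mul η (l := l + 1) (by linarith) k
    push_cast at ih0 ih1 e1 e2 ⊢
    simp only [add_assoc, Nat.reduceAdd] at ih0 ih1 e1 e2 e3 ⊢
    norm_num at ih0 ih1 e1 e2 e3 ⊢
    apply mul_left_cancel₀ p.ne'
    have hs : η / (l + 1) * (l + 1) = η := by field_simp
    generalize η / (l + 1) = s at *
    generalize (1 + η ^ 2 / (l + 1) ^ 2) / (2 * l + 3) = g at *
    linear_combination (k + 2 : ℝ) * e2 - s * e1 + g * e3 + 2 * η * ih1 - ih0 +
      2 * coulombCoeff l η (k + 3) * hs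

lemma coulombCoeff_lower {l : ℝ} (η : ℝ) (hl : -3/2 < l) (hl1 : l ≠ -1) (k : ℕ) :
    (2 * l + 3) * coulombCoeff l η (k + 1) = (k + 2 * l + 4) * coulombCoeff (l + 1) η (k + 1) +
      η / (l + 1) * coulombCoeff (l + 1) η k := by
  have h1 : l + 1 ≠ 0 := fun h => hl1 (by linarith)
  have h2 : l + 2 ≠ 0 := by linarith
  have h3 : 2 * l + 3 ≠ 0 := by linarith
  have h5 : 2 * l + 5 ≠ 0 := by linarith
  have e : coulombCoeff l η 1 = η / (l + 1) := rfl
  have f : coulombCoeff (l + 1) η 1 = η / (l + 2) := by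
    rw [coulombCoeff]; ring
  induction k using Nat.twoStepInduction with
  | zero =>
    simp only [Nat.cast_zero, zero_add, e, f]
    simp only [coulombCoeff]
    field_simp
    ring
  | one =>
    have e' : coulombCoeff l η 2 = (2 * η * (η / (l + 1)) - 1) / (2 * (2 * l + 3)) := by
      rw [eq_div_iff (by positivity), ← e]
      have := coulombCoeff_add_two_mul η hl 0
      simp only [Nat.cast_zero, zero_add, coulombCoeff.eq_1] at this
      linear_combination this
    have f' : coulombCoeff (l + 1) η 2 = (2 * η * (η / (l + 2)) - 1) / (2 * (2 * l + 5)) := by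
      rw [eq_div_iff (by positivity), ← f]
      have := coulombCoeff_add_two_mul η (l := l + 1) (by linarith) 0
      simp only [Nat.cast_zero, zero_add, coulombCoeff.eq_1] at this
      linear_combination this
    norm_num [e', f', f]
    field_simp
    ring
  | more k ih0 ih1 =>
    have hk : (0 : ℝ) ≤ k := k.cast_nonneg
    have p : (0 : ℝ) < ((k : ℝ) + 3) * (k + 2 * l + 4) := by
      apply mul_pos <;> linarith
    have e1 := coulombCoeff_add_two_mul η hl (k + 1)
    have e2 := coulombCoeff_add_two_mul η (l := l + 1) (by linarith) (k + 1)
    have e3 := coulombCoeff_add_two_mul η (l := l + 1) (by linarith) k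
    push_cast at ih0 ih1 e1 e2 ⊢
    simp only [add_assoc, Nat.reduceAdd] at ih0 ih1 e1 e2 e3 ⊢
    norm_num at ih0 ih1 e1 e2 e3 ⊢
    apply mul_left_cancel₀ p.ne'
    have hs : η / (l + 1) * (l + 1) = η := by field_simp
    generalize η / (l + 1) = s at *
    linear_combination (2 * l + 3) * e1 - (k + 2 * l + 4) * e2 + 2 * η * ih1 - ih0 - s * e3 -
      2 * coulombCoeff (l + 1) η (k + 2) * hs

lemma abs_coulombCoeff_succ_le {l η M : ℝ} (hl : -3/2 < l) (hM : 1 ≤ M)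
    (hlM : 2 * |η| + 1 ≤ (2 * l + 3) * M) (k : ℕ) :
    |coulombCoeff l η (k + 1)| ≤
      (|coulombCoeff l η 1| + 2 * |coulombCoeff l η 2|) * (M ^ (k + 1) / (k + 1).factorial) := by
  set A := |coulombCoeff l η 1| + 2 * |coulombCoeff l η 2| with hA
  have hA0 : 0 ≤ A := by positivity
  induction k using Nat.twoStepInduction with
  | zero =>
    simp only [zero_add, pow_one, Nat.factorial_one, Nat.cast_one, div_one]
    nlinarith [abs_nonneg (coulombCoeff l η 1), abs_nonneg (coulombCoeff l η 2)]
  | one =>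
    norm_num
    have : A * 1 ≤ A * M ^ 2 := by gcongr; nlinarith
    have := abs_nonneg (coulombCoeff l η 1)
    linarith
  | more k ih0 ih1 =>
    have hk : (0 : ℝ) ≤ k := k.cast_nonneg
    have e := coulombCoeff_add_two_mul η hl (k + 1)
    have p : 0 < ((k : ℝ) + 3) * (k + 2 * l + 4) := by apply mul_pos <;> linarith
    have e' : ((k : ℝ) + 3) * (k + 2 * l + 4) * |coulombCoeff l η (k + 3)| ≤
        2 * |η| * |coulombCoeff l η (k + 2)| + |coulombCoeff l η (k + 1)| := by
      rw [← abs_of_pos p, ← abs_mul]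
      have : ((k : ℝ) + 3) * (k + 2 * l + 4) * coulombCoeff l η (k + 3) =
          2 * η * coulombCoeff l η (k + 2) - coulombCoeff l η (k + 1) := by
        push_cast at e
        rw [← e]; ring_nf
      rw [this]
      refine (abs_sub _ _).trans ?_
      rw [abs_mul, abs_mul, abs_two]
    set w := A * (M ^ (k + 1) / (k + 1).factorial) with hw
    have hw0 : 0 ≤ w := by positivity
    have w1 : A * (M ^ (k + 1 + 1) / (k + 1 + 1).factorial) = w * M / (k + 2) := by
      rw [hw, Nat.factorial_succ (k + 1)]
      push_cast
      field_simp
      ring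
    have w2 : A * (M ^ (k + 2 + 1) / (k + 2 + 1).factorial) = w * M ^ 2 / ((k + 2) * (k + 3)) := by
      rw [hw, Nat.factorial_succ (k + 2), Nat.factorial_succ (k + 1)]
      push_cast
      field_simp
      ring
    rw [w1] at ih1
    rw [w2]
    refine le_of_mul_le_mul_left (e'.trans ?_) p
    calc 2 * |η| * |coulombCoeff l η (k + 2)| + |coulombCoeff l η (k + 1)|
        ≤ 2 * |η| * (w * M / (k + 2)) + w := by gcongr
      _ = w * (2 * |η| * M + (k + 2)) / (k + 2) := by field_simp
      _ ≤ w * (M ^ 2 * (k + 2 * l + 4)) / (k + 2) := by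
        gcongr
        nlinarith [mul_le_mul_of_nonneg_right hlM (zero_le_one.trans hM),
          mul_le_mul_of_nonneg_left (one_le_pow₀ hM (n := 2)) (show (0:ℝ) ≤ k + 1 by positivity)]
      _ = _ := by field_simp

/-- A geometric rate admissible in `abs_coulombCoeff_succ_le` for all parameters `≥ l`. -/
noncomputable def coulombRate (l η : ℝ) : ℝ := 1 + (2 * |η| + 1) / (2 * l + 3)

lemma one_le_coulombRate {l : ℝ} (η : ℝ) (hl : -3/2 < l) : 1 ≤ coulombRate l η := by
  have : 0 < 2 * l + 3 := by linarith
  have : 0 ≤ (2 * |η| + 1) / (2 * l + 3) := by positivity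
  rw [coulombRate]
  linarith

lemma le_mul_coulombRate {l l' : ℝ} (η : ℝ) (hl : -3/2 < l) (hl' : l ≤ l') :
    2 * |η| + 1 ≤ (2 * l' + 3) * coulombRate l η := by
  have h : 0 < 2 * l + 3 := by linarith
  calc 2 * |η| + 1 = (2 * l + 3) * ((2 * |η| + 1) / (2 * l + 3)) := by field_simp
    _ ≤ (2 * l' + 3) * coulombRate l η := by
      have h0 : 0 ≤ (2 * |η| + 1) / (2 * l + 3) := by positivity
      rw [coulombRate]
      gcongr <;> linarith

/-- The constant in the coefficient bound `abs_coulombCoeff_succ_le`. -/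
noncomputable def coulombConst (l η : ℝ) : ℝ :=
  |coulombCoeff l η 1| + 2 * |coulombCoeff l η 2|

lemma coulombConst_nonneg (l η : ℝ) : 0 ≤ coulombConst l η := by
  rw [coulombConst]; positivity

lemma tendsto_coulombConst (l η : ℝ) :
    Filter.Tendsto (fun n : ℕ => coulombConst (l + n) η) Filter.atTop (nhds 0) := by
  have hn : Filter.Tendsto (fun n : ℕ => l + (n : ℝ)) Filter.atTop Filter.atTop :=
    Filter.tendsto_atTop_add_const_left _ _ tendsto_natCast_atTop_atTop
  have h1 : Filter.Tendsto (fun n : ℕ => coulombCoeff (l + n) η 1) Filter.atTop (nhds 0) :=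
    (Filter.tendsto_atTop_add_const_right _ 1 hn).const_div_atTop η
  have h2 : Filter.Tendsto (fun n : ℕ => coulombCoeff (l + n) η 2) Filter.atTop (nhds 0) := by
    have hd : Filter.Tendsto (fun n : ℕ => (((0 : ℕ) : ℝ) + 2) * ((((0 : ℕ) : ℝ) + 2) +
        2 * (l + n) + 1)) Filter.atTop Filter.atTop :=
      (Filter.tendsto_atTop_add_const_right _ 1 (Filter.tendsto_atTop_add_const_left _ _
        (hn.const_mul_atTop two_pos))).const_mul_atTop (by norm_num)
    exact ((h1.const_mul (2 * η)).sub tendsto_const_nhds).div_atTop hd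
  simpa [coulombConst] using h1.abs.add (h2.abs.const_mul 2)

lemma abs_coulombCoeff_succ_mul_pow_le {l l' r x : ℝ} (η : ℝ) (hl : -3/2 < l) (hl' : l ≤ l')
    (hx : |x| ≤ r) (k : ℕ) :
    |coulombCoeff l' η (k + 1) * x ^ (k + 1)| ≤
      coulombConst l' η * ((coulombRate l η * r) ^ (k + 1) / (k + 1).factorial) := by
  have hM := one_le_coulombRate η hl
  have h := abs_coulombCoeff_succ_le (hl.trans_le hl') hM (le_mul_coulombRate η hl hl') k
  rw [← coulombConst] at h
  have h0 : 0 ≤ coulombConst l' η * (coulombRate l η ^ (k + 1) / (k + 1).factorial) :=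
    (abs_nonneg _).trans h
  rw [abs_mul, abs_pow]
  calc _ ≤ coulombConst l' η * (coulombRate l η ^ (k + 1) / (k + 1).factorial) * r ^ (k + 1) := by
        gcongr
    _ = _ := by rw [mul_pow]; ring

lemma summable_coulombPhi {l : ℝ} (η : ℝ) (hl : -3/2 < l) (x : ℝ) :
    Summable fun k => coulombCoeff l η k * x ^ k := by
  rw [← summable_nat_add_iff 1]
  refine Summable.of_norm_bounded ?_ (abs_coulombCoeff_succ_mul_pow_le η hl le_rfl (le_refl |x|))
  exact ((summable_nat_add_iff 1).mpr (Real.summable_pow_div_factorial _)).mul_left _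

lemma hasSum_coulombPhi_sub_one {l : ℝ} (η : ℝ) (hl : -3/2 < l) (x : ℝ) :
    HasSum (fun k => coulombCoeff l η (k + 1) * x ^ (k + 1)) (coulombPhi l η x - 1) := by
  have := (hasSum_nat_add_iff' 1).mpr (summable_coulombPhi η hl x).hasSum
  simpa [coulombCoeff.eq_1, coulombPhi] using this

lemma abs_coulombPhi_sub_one_le {l l' r x : ℝ} (η : ℝ) (hl : -3/2 < l) (hl' : l ≤ l')
    (hx : |x| ≤ r) :
    |coulombPhi l' η x - 1| ≤ coulombConst l' η * Real.exp (coulombRate l η * r) := by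
  have hs := Real.summable_pow_div_factorial (coulombRate l η * r)
  have h1 := (hasSum_coulombPhi_sub_one η (hl.trans_le hl') x)
  rw [← h1.tsum_eq]
  refine (tsum_of_norm_bounded (f := fun k => coulombCoeff l' η (k + 1) * x ^ (k + 1))
    (((summable_nat_add_iff 1).mpr hs).mul_left _).hasSum (abs_coulombCoeff_succ_mul_pow_le η hl hl' hx)).trans ?_
  rw [tsum_mul_left]
  gcongr
  · exact coulombConst_nonneg _ _
  · rw [Real.exp_eq_exp_ℝ, NormedSpace.exp_eq_tsum_div]
    beta_reduce
    rw [hs.tsum_eq_zero_add]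
    simp

lemma hasSum_deriv_coulombPhi {l : ℝ} (η : ℝ) (hl : -3/2 < l) (x : ℝ) :
    HasSum (fun k : ℕ => (k + 1) * coulombCoeff l η (k + 1) * x ^ k)
      (deriv (coulombPhi l η) x) := by
  have hM := one_le_coulombRate η hl
  set r := |x| + 1 with hr
  set u : ℕ → ℝ := fun k => coulombConst l η *
    (k * coulombRate l η ^ k * r ^ (k - 1) / k.factorial) with hu
  have hus : Summable u := by
    rw [← summable_nat_add_iff 1]
    refine ((Real.summable_pow_div_factorial (coulombRate l η * r)).mul_left
      (coulombConst l η * coulombRate l η)).congr fun k => ?_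
    simp only [hu, Nat.add_sub_cancel, Nat.factorial_succ]
    push_cast
    field_simp
    ring_nf
  have hbound : ∀ (k : ℕ) (y : ℝ), y ∈ Metric.ball (0 : ℝ) r →
      ‖coulombCoeff l η k * (k * y ^ (k - 1))‖ ≤ u k := by
    intro k y hy
    have hy : |y| ≤ r := by simpa using (mem_ball_zero_iff.mp hy).le
    cases k with
    | zero => simp [hu]
    | succ k =>
      have h := abs_coulombCoeff_succ_le hl hM (le_mul_coulombRate η hl le_rfl) k
      rw [← coulombConst] at h
      have h0 : 0 ≤ coulombConst l η * (coulombRate l η ^ (k + 1) / (k + 1).factorial) :=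
        (abs_nonneg _).trans h
      rw [Real.norm_eq_abs, abs_mul, abs_mul, abs_pow, Nat.abs_cast]
      calc _ ≤ coulombConst l η * (coulombRate l η ^ (k + 1) / (k + 1).factorial) *
            ((k + 1 : ℕ) * r ^ (k + 1 - 1)) := by gcongr
        _ = _ := by simp only [hu]; ring
  have hd := hasDerivAt_tsum_of_isPreconnected (𝕜 := ℝ) (F := ℝ) hus Metric.isOpen_ball
    (convex_ball (0 : ℝ) r).isPreconnected
    (fun k y _ => (hasDerivAt_pow k y).const_mul (coulombCoeff l η k)) hbound
    (Metric.mem_ball_self (by positivity)) (summable_coulombPhi η hl 0)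
    (y := x) (by simp [hr])
  have hd' : deriv (coulombPhi l η) x = ∑' k : ℕ, coulombCoeff l η k * (k * x ^ (k - 1)) :=
    hd.deriv
  have hs : Summable fun k : ℕ => coulombCoeff l η k * (k * x ^ (k - 1)) :=
    Summable.of_norm_bounded hus fun k => hbound k x (by simp [hr])
  have := (hasSum_nat_add_iff' 1).mpr hs.hasSum
  rw [← hd'] at this
  simp only [Finset.range_one, Finset.sum_singleton, Nat.cast_zero, zero_mul, mul_zero,
    sub_zero, Nat.add_sub_cancel] at this
  refine this.congr_fun fun k => ?_
  push_cast
  ring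

lemma deriv_coulombPhi {l : ℝ} (η : ℝ) (hl : -3/2 < l) (hl1 : l ≠ -1) (x : ℝ) :
    deriv (coulombPhi l η) x = η / (l + 1) * coulombPhi l η x -
      (1 + η ^ 2 / (l + 1) ^ 2) / (2 * l + 3) * x * coulombPhi (l + 1) η x := by
  have h1 := (hasSum_nat_add_iff' 1).mpr (hasSum_deriv_coulombPhi η hl x)
  have h2 := (hasSum_coulombPhi_sub_one η hl x).mul_left (η / (l + 1))
  have h3 := ((summable_coulombPhi η (l := l + 1) (by linarith) x).hasSum).mul_left
    ((1 + η ^ 2 / (l + 1) ^ 2) / (2 * l + 3) * x)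
  have h4 := h1.unique ((h2.sub h3).congr_fun fun k => ?_)
  · simp only [Finset.range_one, Finset.sum_singleton, Nat.cast_zero, zero_add, pow_zero,
      coulombCoeff.eq_2] at h4
    rw [coulombPhi.eq_def (l + 1)]
    linear_combination h4
  · push_cast
    linear_combination x ^ (k + 1) * coulombCoeff_raise η hl hl1 k

lemma coulombPhi_lower {l : ℝ} (η : ℝ) (hl : -3/2 < l) (hl1 : l ≠ -1) (x : ℝ) :
    (2 * l + 3) * coulombPhi l η x = x * deriv (coulombPhi (l + 1) η) x +
      (2 * l + 3 + η / (l + 1) * x) * coulombPhi (l + 1) η x := by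
  have hl' : -3/2 < l + 1 := by linarith
  have h1 := (hasSum_coulombPhi_sub_one η hl x).mul_left (2 * l + 3)
  have h2 := (hasSum_coulombPhi_sub_one η hl' x).mul_left (2 * l + 3)
  have h3 := (summable_coulombPhi η hl' x).hasSum.mul_left (η / (l + 1) * x)
  have h4 := (hasSum_deriv_coulombPhi η hl' x).mul_left x
  have h5 := h1.unique (((h4.add h2).add h3).congr_fun fun k => ?_)
  · rw [coulombPhi.eq_def (l + 1)] at h5 ⊢
    linear_combination h5
  · linear_combination x ^ (k + 1) * coulombCoeff_lower η hl hl1 k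

lemma coulombPhi_three_term {l : ℝ} (η : ℝ) (hl : -3/2 < l) (hl1 : l ≠ -1) (x : ℝ) :
    coulombPhi l η x = (1 + η / ((l + 1) * (l + 2)) * x) * coulombPhi (l + 1) η x -
      4 * betaR l η 1 * x ^ 2 * coulombPhi (l + 2) η x := by
  have h1 : l + 1 ≠ 0 := fun h => hl1 (by linarith)
  have h2 : l + 2 ≠ 0 := by linarith
  have h3 : 2 * l + 3 ≠ 0 := by linarith
  have h5 : 2 * l + 5 ≠ 0 := by linarith
  have hA := deriv_coulombPhi η (l := l + 1) (by linarith) (by linarith) x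
  have hB := coulombPhi_lower η hl hl1 x
  rw [hA, show l + 1 + 1 = l + 2 by ring, show 2 * (l + 1) + 3 = 2 * l + 5 by ring] at hB
  have hb : betaR l η 1 = ((l + 2) ^ 2 + η ^ 2) /
      (2 * (2 * l + 3) * (2 * (l + 2)) * (2 * l + 5) * (l + 2)) := by
    rw [betaR]; push_cast; ring_nf
  apply mul_left_cancel₀ h3
  rw [hB, hb]
  have h6 : 2 * l + 3 = l + 1 + (l + 2) := by ring
  generalize 2 * l + 5 = p at *
  generalize hq : 2 * l + 3 = q at *
  field_simp
  rw [h6]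
  ring

lemma natDegree_Rpoly_le (l η : ℝ) (n : ℕ) : (Rpoly l η n).natDegree ≤ n := by
  induction n using Nat.twoStepInduction with
  | zero => simp [Rpoly]
  | one => rw [Rpoly]; compute_degree
  | more n ih0 ih1 =>
    rw [Rpoly]
    refine natDegree_sub_le_of_le (m := n + 2) (n := n + 2) ?_ ?_ |>.trans (by simp)
    · exact (natDegree_mul_le_of_le (natDegree_X_sub_C_le _) ih1).trans (by omega)
    · exact (natDegree_C_mul_le _ _).trans (ih0.trans (by omega))

/-- The reversed polynomial `(2x)^n R_{n,ℓ,η}(1/(2x))`. -/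
noncomputable def reversedR (l η : ℝ) (n : ℕ) (x : ℝ) : ℝ :=
  eval (2 * x) (reflect n (Rpoly l η n))

lemma reflect_add_of_natDegree_le {p : ℝ[X]} {n : ℕ} (hp : p.natDegree ≤ n) (m : ℕ) :
    reflect (m + n) p = X ^ m * reflect n p := by
  have := reflect_mul (1 : ℝ[X]) p (F := m) (G := n) (by simp) hp
  rwa [one_mul, reflect_one] at this

lemma reversedR_zero (l η x : ℝ) : reversedR l η 0 x = 1 := by
  simp [reversedR, Rpoly]

lemma reversedR_one (l η x : ℝ) : reversedR l η 1 x = 1 + η / ((l + 1) * (l + 2)) * x := by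
  simp only [reversedR, Rpoly, reflect_add, reflect_one_X, reflect_C, eval_add, eval_mul, eval_C,
    eval_one, pow_one, eval_X, mul_assoc (2 : ℝ), ← div_div _ (2 : ℝ)]
  ring

lemma reversedR_add_two (l η : ℝ) (n : ℕ) (x : ℝ) :
    reversedR l η (n + 2) x = (1 - 2 * alphaR l η (n + 1) * x) * reversedR l η (n + 1) x -
      4 * betaR l η (n + 1) * x ^ 2 * reversedR l η n x := by
  have h : reflect (n + 2) (Rpoly l η (n + 2)) =
      (1 - C (alphaR l η (n + 1)) * X) * reflect (n + 1) (Rpoly l η (n + 1)) -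
        C (betaR l η (n + 1)) * (X ^ 2 * reflect n (Rpoly l η n)) := by
    rw [Rpoly, reflect_sub, reflect_C_mul, add_comm n 2,
      reflect_add_of_natDegree_le (natDegree_Rpoly_le l η n) 2, show 2 + n = 1 + (n + 1) by ring,
      reflect_mul _ _ (natDegree_X_sub_C_le _) (natDegree_Rpoly_le l η (n + 1)), reflect_sub,
      reflect_one_X, reflect_C, pow_one]
  simp only [reversedR, h, eval_sub, eval_mul, eval_C, eval_one, eval_X, eval_pow]
  ring

lemma reversedD_succ (l η H : ℝ) (n : ℕ) (x : ℝ) :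
    reversedD l η H (n + 1) x = (η / (l + 1) * x + H) * reversedR l η (n + 1) x -
      (1 + η ^ 2 / (l + 1) ^ 2) / (2 * l + 3) * x ^ 2 * reversedR (l + 1) η n x := by
  have hd : (C (η / (2 * (l + 1))) + C H * X : ℝ[X]).natDegree ≤ 1 := by compute_degree
  have hr : reflect 1 (C (η / (2 * (l + 1))) + C H * X : ℝ[X]) =
      C (η / (2 * (l + 1))) * X + C H := by
    rw [reflect_add, reflect_C, reflect_C_mul, reflect_one_X, pow_one, mul_one]
  have h : reflect (n + 1 + 1) (Dpoly l η H (n + 1)) =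
      (C (η / (2 * (l + 1))) * X + C H) * reflect (n + 1) (Rpoly l η (n + 1)) -
        C ((1 + η ^ 2 / (l + 1) ^ 2) / (4 * (2 * l + 3))) *
          (X ^ 2 * reflect n (Rpoly (l + 1) η n)) := by
    rw [Dpoly, reflect_sub, reflect_C_mul, Nat.add_sub_cancel, show n + 1 + 1 = 2 + n by ring,
      reflect_add_of_natDegree_le (natDegree_Rpoly_le (l + 1) η n) 2,
      show 2 + n = 1 + (n + 1) by ring, reflect_mul _ _ hd (natDegree_Rpoly_le l η (n + 1)), hr]
  simp only [reversedD, h, reversedR, eval_sub, eval_mul, eval_C, eval_add, eval_X, eval_pow,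
    ← div_div _ (2 : ℝ), ← div_div _ (4 : ℝ)]
  ring

lemma reversedR_apply_zero (l η : ℝ) (n : ℕ) : reversedR l η n 0 = 1 := by
  induction n using Nat.twoStepInduction with
  | zero => exact reversedR_zero l η 0
  | one => simp [reversedR_one]
  | more n _ ih => simp [reversedR_add_two, ih]

lemma coulombPhi_eq_reversedR {l : ℝ} (η : ℝ) (hl : -3/2 < l) (hl1 : l ≠ -1) (n : ℕ) (x : ℝ) :
    coulombPhi l η x = reversedR l η (n + 1) x * coulombPhi (l + (n + 1 : ℕ)) η x -
      4 * betaR l η (n + 1) * x ^ 2 * reversedR l η n x * coulombPhi (l + (n + 2 : ℕ)) η x := by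
  induction n with
  | zero =>
    simpa [reversedR_zero, reversedR_one] using coulombPhi_three_term η hl hl1 x
  | succ n ih =>
    have hn : (0 : ℝ) ≤ n := n.cast_nonneg
    have hr := coulombPhi_three_term η (l := l + (n + 1 : ℕ)) (by push_cast; linarith)
      (by push_cast; linarith) x
    have ha : η / ((l + (n + 1 : ℕ) + 1) * (l + (n + 1 : ℕ) + 2)) =
        -2 * alphaR l η (n + 1) := by
      rw [alphaR, mul_assoc 2, neg_div, ← div_div _ (2 : ℝ)]
      push_cast
      ring
    have hb : betaR (l + (n + 1 : ℕ)) η 1 = betaR l η (n + 2) := by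
      simp only [betaR]; push_cast; ring_nf
    rw [ha, hb] at hr
    rw [ih, hr, reversedR_add_two]
    have e1 : l + ((n + 1 : ℕ) : ℝ) + 1 = l + ((n + 2 : ℕ) : ℝ) := by push_cast; ring
    have e2 : l + ((n + 1 : ℕ) : ℝ) + 2 = l + ((n + 1 + 2 : ℕ) : ℝ) := by push_cast; ring
    rw [e1, e2, show n + 1 + 1 = n + 2 by ring]
    ring

lemma exists_recurrence_bound {l : ℝ} (η : ℝ) (hl : -3/2 < l) :
    ∃ K : ℝ, 0 ≤ K ∧ ∀ n : ℕ, |alphaR l η (n + 1)| ≤ K / ((n : ℝ) + 1) ^ 2 ∧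
      |betaR l η (n + 1)| ≤ K / ((n : ℝ) + 1) ^ 2 := by
  obtain ⟨c, hc0, hc1, hc⟩ : ∃ c : ℝ, 0 < c ∧ c ≤ 1 / 2 ∧ c ≤ 2 * l + 3 :=
    ⟨min (1 / 2) (2 * l + 3), lt_min (by norm_num) (by linarith), min_le_left _ _,
      min_le_right _ _⟩
  refine ⟨(|η| + 1 + 4 * η ^ 2) / c ^ 2, by positivity, fun n => ?_⟩
  have hn : (0 : ℝ) ≤ n := n.cast_nonneg
  set m := l + n + 2 with hm
  have hcn : c * n ≤ 1 / 2 * n := by gcongr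
  have h1 : c * (n + 1) ≤ m := by rw [hm]; linarith
  have h2 : c * (n + 1) ≤ 2 * m - 1 := by rw [hm]; linarith
  have hcn0 : 0 < c * (n + 1) := by positivity
  have hm0 : 1 / 2 ≤ m := by rw [hm]; linarith
  constructor
  · have e : alphaR l η (n + 1) = -η / (2 * m * (m + 1)) := by
      rw [alphaR, hm]; push_cast; ring_nf
    have hp : 0 < 2 * m * (m + 1) := by positivity
    rw [e, abs_div, abs_neg, abs_of_pos hp, div_div, ← mul_pow]
    apply div_le_div₀ (by positivity) (by nlinarith [sq_nonneg η]) (by positivity)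
    nlinarith
  · have e : betaR l η (n + 1) = (1 + η ^ 2 / m ^ 2) / (4 * ((2 * m - 1) * (2 * m + 1))) := by
      have hm1 : 2 * m - 1 ≠ 0 := by linarith
      have hm2 : 2 * m + 1 ≠ 0 := by linarith
      have : betaR l η (n + 1) = (m ^ 2 + η ^ 2) /
          (2 * (2 * m - 1) * (2 * m) * (2 * m + 1) * m) := by
        rw [betaR, hm]; push_cast; ring_nf
      rw [this]
      field_simp
      ring
    have hp : 0 < (2 * m - 1) * (2 * m + 1) := by apply mul_pos <;> linarith
    rw [e, abs_of_pos (by positivity), div_div, ← mul_pow]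
    have hη : η ^ 2 / m ^ 2 ≤ 4 * η ^ 2 := by
      rw [div_le_iff₀ (by positivity)]
      nlinarith [mul_nonneg (sq_nonneg η) (show 0 ≤ 4 * m ^ 2 - 1 by nlinarith)]
    apply div_le_div₀ (by positivity) (by linarith [abs_nonneg η]) (by positivity)
    nlinarith [mul_le_mul h2 h2 hcn0.le (by linarith)]

lemma summable_const_div_succ_sq (K : ℝ) : Summable fun n : ℕ => K / ((n : ℝ) + 1) ^ 2 := by
  have := (summable_nat_add_iff 1).mpr (Real.summable_nat_pow_inv.mpr one_lt_two)
  simpa [div_eq_mul_inv] using this.mul_left K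

/-- A solution of a perturbed three-term recurrence with summable perturbations is bounded. -/
lemma abs_le_of_three_term {u e : ℕ → ℝ} {B : ℝ} (he0 : ∀ n, 0 ≤ e n) (he : Summable e)
    (h0 : |u 0| ≤ B) (h1 : |u 1| ≤ B)
    (h : ∀ n, |u (n + 2)| ≤ (1 + e n) * max |u n| |u (n + 1)|) (n : ℕ) :
    |u n| ≤ B * Real.exp (∑' k, e k) := by
  have hB : 0 ≤ B := (abs_nonneg _).trans h0
  have key : ∀ n, max |u n| |u (n + 1)| ≤ B * Real.exp (∑ k ∈ Finset.range n, e k) := by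
    intro n
    induction n with
    | zero => simp [h0, h1]
    | succ n ih =>
      have hn := he0 n
      have hm : 0 ≤ max |u n| |u (n + 1)| := (abs_nonneg _).trans (le_max_left _ _)
      have h3 : (1 + e n) * max |u n| |u (n + 1)| ≤
          B * Real.exp (∑ k ∈ Finset.range (n + 1), e k) := by
        rw [Finset.sum_range_succ, Real.exp_add, ← mul_assoc, mul_comm]
        gcongr
        linarith [Real.add_one_le_exp (e n)]
      refine max_le (le_trans ?_ h3) ((h n).trans h3)
      nlinarith [he0 n, le_max_right |u n| |u (n + 1)|]
  refine (le_max_left _ _).trans ((key n).trans ?_)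
  gcongr
  exact he.sum_le_tsum _ fun k _ => he0 k

lemma exists_abs_reversedR_le {l : ℝ} (η : ℝ) (hl : -3/2 < l) (r : ℝ) :
    ∃ B : ℝ, ∀ x, |x| ≤ r → ∀ n, |reversedR l η n x| ≤ B := by
  obtain ⟨K, hK0, hK⟩ := exists_recurrence_bound η hl
  refine ⟨(1 + |η / ((l + 1) * (l + 2))| * r) *
    Real.exp (∑' n : ℕ, (2 * K * r + 4 * K * r ^ 2) / ((n : ℝ) + 1) ^ 2), fun x hx n => ?_⟩
  have hr : 0 ≤ r := (abs_nonneg x).trans hx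
  refine abs_le_of_three_term (u := fun n => reversedR l η n x) (fun n => by positivity)
    (summable_const_div_succ_sq _) ?_ ?_ (fun n => ?_) n
  · rw [reversedR_zero, abs_one]
    exact le_add_of_nonneg_right (by positivity)
  · rw [reversedR_one]
    refine (abs_add_le _ _).trans ?_
    rw [abs_one, abs_mul]
    gcongr
  · set m := max |reversedR l η n x| |reversedR l η (n + 1) x| with hm
    obtain ⟨ha, hb⟩ := hK n
    have hx2 : x ^ 2 ≤ r ^ 2 := by rw [← sq_abs]; gcongr
    have hm0 : 0 ≤ m := (abs_nonneg _).trans (le_max_left _ _)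
    have h1 : |1 - 2 * alphaR l η (n + 1) * x| ≤ 1 + 2 * (K / ((n : ℝ) + 1) ^ 2) * r := by
      refine (abs_sub _ _).trans ?_
      rw [abs_one, abs_mul, abs_mul, abs_two]
      gcongr
    have h2 : |4 * betaR l η (n + 1) * x ^ 2| ≤ 4 * (K / ((n : ℝ) + 1) ^ 2) * r ^ 2 := by
      rw [abs_mul, abs_mul, abs_of_nonneg (sq_nonneg x), abs_of_pos (by norm_num : (0 : ℝ) < 4)]
      gcongr
    rw [reversedR_add_two]
    refine (abs_sub _ _).trans ?_
    rw [abs_mul, abs_mul (4 * _ * _)]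
    calc _ ≤ (1 + 2 * (K / ((n : ℝ) + 1) ^ 2) * r) * m +
          4 * (K / ((n : ℝ) + 1) ^ 2) * r ^ 2 * m := by
          gcongr
          · exact le_max_right _ _
          · exact le_max_left _ _
      _ = _ := by ring

lemma tendsto_betaR {l : ℝ} (η : ℝ) (hl : -3/2 < l) :
    Filter.Tendsto (fun n => betaR l η (n + 1)) Filter.atTop (nhds 0) := by
  obtain ⟨K, -, hK⟩ := exists_recurrence_bound η hl
  exact squeeze_zero_norm (fun n => (hK n).2) (summable_const_div_succ_sq K).tendsto_atTop_zero

lemma exists_reversedR_sub_coulombPhi_le {l : ℝ} (η : ℝ) (hl : -3/2 < l) (hl1 : l ≠ -1) (r : ℝ) :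
    ∃ e : ℕ → ℝ, Filter.Tendsto e Filter.atTop (nhds 0) ∧
      ∀ n x, |x| ≤ r → |reversedR l η (n + 1) x - coulombPhi l η x| ≤ e n := by
  obtain ⟨B, hB⟩ := exists_abs_reversedR_le η hl r
  set E := Real.exp (coulombRate l η * r) with hE
  refine ⟨fun n => B * (coulombConst (l + (n + 1 : ℕ)) η * E) +
    4 * |betaR l η (n + 1)| * r ^ 2 * B * (1 + coulombConst (l + (n + 2 : ℕ)) η * E), ?_,
    fun n x hx => ?_⟩
  · have hc := tendsto_coulombConst l η
    have h1 := (hc.comp (Filter.tendsto_add_atTop_nat 1)).mul_const E |>.const_mul B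
    have h2 := (hc.comp (Filter.tendsto_add_atTop_nat 2)).mul_const E |>.const_add 1
    have h3 := (((tendsto_betaR η hl).abs.const_mul 4).mul_const (r ^ 2)).mul_const B
    simpa using h1.add (h3.mul h2)
  · have hB0 : 0 ≤ B := (abs_nonneg _).trans (hB x hx 0)
    have hx2 : x ^ 2 ≤ r ^ 2 := by rw [← sq_abs]; gcongr
    have h1 := abs_coulombPhi_sub_one_le (l' := l + (n + 1 : ℕ)) η hl
      (le_add_of_nonneg_right (Nat.cast_nonneg _)) hx
    have h2 := abs_coulombPhi_sub_one_le (l' := l + (n + 2 : ℕ)) η hl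
      (le_add_of_nonneg_right (Nat.cast_nonneg _)) hx
    have h2' : |coulombPhi (l + (n + 2 : ℕ)) η x| ≤
        1 + coulombConst (l + (n + 2 : ℕ)) η * E := by
      have := abs_sub_abs_le_abs_sub (coulombPhi (l + (n + 2 : ℕ)) η x) 1
      rw [abs_one] at this
      linarith
    have e : reversedR l η (n + 1) x - coulombPhi l η x =
        -(reversedR l η (n + 1) x * (coulombPhi (l + (n + 1 : ℕ)) η x - 1)) +
        4 * betaR l η (n + 1) * x ^ 2 * reversedR l η n x *
          coulombPhi (l + (n + 2 : ℕ)) η x := by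
      rw [coulombPhi_eq_reversedR η hl hl1 n x]; ring
    rw [e]
    refine (abs_add_le _ _).trans ?_
    rw [abs_neg, abs_mul, abs_mul, abs_mul, abs_mul, abs_mul, abs_of_nonneg (sq_nonneg x),
      abs_of_pos (by norm_num : (0 : ℝ) < 4)]
    beta_reduce
    gcongr
    · exact hB x hx _
    · exact hB x hx _

lemma tendstoUniformlyOn_reversedD {l : ℝ} (η : ℝ) (hl : -3/2 < l) (hl1 : l ≠ -1) (H : ℝ)
    {K : Set ℝ} (hK : Bornology.IsBounded K) :
    TendstoUniformlyOn (fun n x => reversedD l η H n x)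
      (fun x => x * deriv (coulombPhi l η) x + H * coulombPhi l η x) Filter.atTop K := by
  obtain ⟨r, hr⟩ := hK.exists_norm_le
  obtain ⟨e, he, hle⟩ := exists_reversedR_sub_coulombPhi_le η hl hl1 r
  obtain ⟨e', he', hle'⟩ := exists_reversedR_sub_coulombPhi_le (l := l + 1) η (by linarith)
    (by linarith) r
  set g := (1 + η ^ 2 / (l + 1) ^ 2) / (2 * l + 3) with hg
  have hg0 : 0 ≤ g := div_nonneg (by positivity) (by linarith)
  have hlim : Filter.Tendsto (fun n => (|η / (l + 1)| * r + |H|) * e (n + 1) + g * r ^ 2 * e' n)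
      Filter.atTop (nhds 0) := by
    simpa using ((he.comp (Filter.tendsto_add_atTop_nat 1)).const_mul _).add
      (he'.const_mul (g * r ^ 2))
  rw [Metric.tendstoUniformlyOn_iff]
  intro ε hε
  rw [← Filter.map_add_atTop_eq_nat 2, Filter.eventually_map]
  filter_upwards [hlim.eventually_lt_const hε] with n hn x hxK
  have hx : |x| ≤ r := hr x hxK
  refine lt_of_le_of_lt ?_ hn
  have hd : reversedD l η H (n + 2) x -
      (x * deriv (coulombPhi l η) x + H * coulombPhi l η x) =
      (η / (l + 1) * x + H) * (reversedR l η (n + 1 + 1) x - coulombPhi l η x) -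
        g * x ^ 2 * (reversedR (l + 1) η (n + 1) x - coulombPhi (l + 1) η x) := by
    rw [reversedD_succ l η H (n + 1), deriv_coulombPhi η hl hl1]
    ring
  have hx2 : x ^ 2 ≤ r ^ 2 := by rw [← sq_abs]; gcongr
  have h1 : |η / (l + 1) * x + H| ≤ |η / (l + 1)| * r + |H| := by
    refine (abs_add_le _ _).trans ?_
    rw [abs_mul]
    gcongr
  rw [dist_comm, Real.dist_eq, hd]
  refine (abs_sub _ _).trans ?_
  rw [abs_mul, abs_mul, abs_mul g, abs_of_nonneg hg0, abs_of_nonneg (sq_nonneg x)]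
  have hr0 : 0 ≤ r := (abs_nonneg x).trans hx
  gcongr
  · exact hle _ _ hx
  · exact hle' _ _ hx

/-- Proposition 5.1: (2x)^{n+1} D_{n,ℓ,η}(H; 1/(2x)) → x φ'_{ℓ,η}(x) + H φ_{ℓ,η}(x) as
n → ∞, for every x ∈ ℝ (the reversed polynomial takes the value H at x = 0), and the
convergence is uniform on every compact subset of ℝ. -/
theorem stmt_12 (l η : ℝ) (hl : -3/2 < l) (hl1 : l ≠ -1) (hη : η ≠ 0) (H : ℝ) :
    (∀ x : ℝ, Filter.Tendsto (fun n => reversedD l η H n x) Filter.atTop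
        (nhds (x * deriv (coulombPhi l η) x + H * coulombPhi l η x))) ∧
      (∀ n : ℕ, 1 ≤ n → reversedD l η H n 0 = H) ∧
      ∀ K : Set ℝ, IsCompact K →
        TendstoUniformlyOn (fun n x => reversedD l η H n x)
          (fun x => x * deriv (coulombPhi l η) x + H * coulombPhi l η x) Filter.atTop K := by
  have hu := fun (K : Set ℝ) hK => tendstoUniformlyOn_reversedD η hl hl1 H (K := K) hK
  refine ⟨fun x => (hu {x} Bornology.isBounded_singleton).tendsto_at rfl, fun n hn => ?_,
    fun K hK => hu K hK.isBounded⟩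
  obtain ⟨n, rfl⟩ := Nat.exists_eq_add_of_le' hn
  simp [reversedD_succ, reversedR_apply_zero]
end

section
/- Let η ≠ 0 and ℓ > −1. Then every positive zero of the regular Coulomb wave function F_{ℓ,η} (equivalently, every positive zero of φ_{ℓ,η}) is strictly greater than η + √(η² + (ℓ+1)²): if x > 0 and φ_{ℓ,η}(x) = 0, then x > η + √(η² + (ℓ+1)²) > 0. -/
open Set

/-- The coefficient sequence of the derivative of `∑ a k * x ^ k`. -/
def derivCoeff (a : ℕ → ℝ) (k : ℕ) : ℝ := ((k : ℝ) + 1) * a (k + 1)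

theorem summable_mul_pow_of_exp_bound {a : ℕ → ℝ} {C M : ℝ}
    (h : ∀ k, |a k| ≤ C * M ^ k / (k.factorial : ℝ)) (x : ℝ) :
    Summable fun k => a k * x ^ k := by
  refine Summable.of_norm_bounded ((Real.summable_pow_div_factorial (M * |x|)).mul_left C) ?_
  intro k
  rw [Real.norm_eq_abs, abs_mul, abs_pow]
  calc |a k| * |x| ^ k ≤ C * M ^ k / (k.factorial : ℝ) * |x| ^ k := by gcongr; exact h k
    _ = C * ((M * |x|) ^ k / (k.factorial : ℝ)) := by rw [mul_pow]; ring

theorem derivCoeff_exp_bound {a : ℕ → ℝ} {C M : ℝ}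
    (h : ∀ k, |a k| ≤ C * M ^ k / (k.factorial : ℝ)) (k : ℕ) :
    |derivCoeff a k| ≤ (C * M) * M ^ k / (k.factorial : ℝ) := by
  have hk : (0 : ℝ) < (k : ℝ) + 1 := by positivity
  have hf : (0 : ℝ) < (k.factorial : ℝ) := by positivity
  rw [derivCoeff, abs_mul, abs_of_pos hk]
  calc ((k : ℝ) + 1) * |a (k + 1)|
      ≤ ((k : ℝ) + 1) * (C * M ^ (k + 1) / ((k + 1).factorial : ℝ)) := by gcongr; exact h _
    _ = (C * M) * M ^ k / (k.factorial : ℝ) := by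
        rw [Nat.factorial_succ]; push_cast; field_simp; ring

theorem hasDerivAt_tsum_mul_pow_of_exp_bound {a : ℕ → ℝ} {C M : ℝ}
    (h : ∀ k, |a k| ≤ C * M ^ k / (k.factorial : ℝ)) (x : ℝ) :
    HasDerivAt (fun y => ∑' k, a k * y ^ k) (∑' k, derivCoeff a k * x ^ k) x := by
  set B : ℝ := |x| + 1
  have hB : 0 < B := by positivity
  have hu : Summable fun n : ℕ => |a n * n| * B ^ (n - 1) := by
    rw [← summable_nat_add_iff 1]
    have h1 := (summable_mul_pow_of_exp_bound (derivCoeff_exp_bound h) B).abs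
    refine h1.congr fun n => ?_
    rw [derivCoeff, abs_mul, abs_of_pos (pow_pos hB n), Nat.add_sub_cancel, mul_comm (a _)]
    push_cast
    rfl
  have hx : x ∈ Metric.ball (0 : ℝ) B := by simp [B]
  have key := hasDerivAt_tsum_of_isPreconnected (g := fun k y => a k * y ^ k)
    (g' := fun k y => a k * (k * y ^ (k - 1))) hu Metric.isOpen_ball
    (convex_ball (0 : ℝ) B).isPreconnected
    (fun n y _ => (hasDerivAt_pow n y).const_mul (a n))
    (fun n y hy => by
      have hy' : |y| ≤ B := (mem_ball_zero_iff.1 hy).le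
      rw [← mul_assoc, Real.norm_eq_abs, abs_mul, abs_pow]
      gcongr)
    hx (summable_mul_pow_of_exp_bound h x) hx
  refine key.congr_deriv ?_
  have hs : Summable fun k : ℕ => a k * ((k : ℝ) * x ^ (k - 1)) := by
    rw [← summable_nat_add_iff 1]
    refine (summable_mul_pow_of_exp_bound (derivCoeff_exp_bound h) x).congr fun n => ?_
    rw [derivCoeff, Nat.add_sub_cancel]
    push_cast
    ring
  rw [hs.tsum_eq_zero_add]
  simp only [Nat.cast_zero, zero_mul, mul_zero, zero_add, Nat.add_sub_cancel, derivCoeff]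
  refine tsum_congr fun n => ?_
  push_cast
  ring

theorem coulombCoeff_add_two (l η : ℝ) (hl : -1 < l) (k : ℕ) :
    ((k : ℝ) + 2) * ((k : ℝ) + 2 + 2 * l + 1) * coulombCoeff l η (k + 2) =
      2 * η * coulombCoeff l η (k + 1) - coulombCoeff l η k := by
  have hk : (0 : ℝ) ≤ k := k.cast_nonneg
  have h1 : (k : ℝ) + 2 + 2 * l + 1 ≠ 0 := by linarith
  have h2 : (k : ℝ) + 2 ≠ 0 := by positivity
  rw [coulombCoeff]
  field_simp

theorem coulombCoeff_exp_bound (l η : ℝ) (hl : -1 < l) (k : ℕ) :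
    |coulombCoeff l η k| ≤
      (1 + |η / (l + 1)|) * (4 * |η| + 2) ^ k / (k.factorial : ℝ) := by
  set C : ℝ := 1 + |η / (l + 1)| with hC
  set M : ℝ := 4 * |η| + 2 with hM
  have hη := abs_nonneg η
  have hC1 : 1 ≤ C := by rw [hC]; linarith [abs_nonneg (η / (l + 1))]
  have hM2 : 2 ≤ M := by rw [hM]; linarith
  induction k using Nat.strong_induction_on with
  | _ k ih =>
    match k with
    | 0 => simpa [coulombCoeff] using hC1
    | 1 =>
      simp only [coulombCoeff, pow_one, Nat.factorial_one, Nat.cast_one, div_one]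
      nlinarith [abs_nonneg (η / (l + 1))]
    | n + 2 =>
      have ih0 := ih n (by omega)
      have ih1 := ih (n + 1) (by omega)
      have hn : (0 : ℝ) ≤ n := n.cast_nonneg
      have hfac : (0 : ℝ) < (n.factorial : ℝ) := by positivity
      have hrec := coulombCoeff_add_two l η hl n
      have hw : 0 < (n : ℝ) + 2 + 2 * l + 1 := by linarith
      have hw1 : (n : ℝ) + 1 ≤ (n : ℝ) + 2 + 2 * l + 1 := by linarith
      have habs : ((n : ℝ) + 2) * ((n : ℝ) + 1) * |coulombCoeff l η (n + 2)| ≤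
          2 * |η| * |coulombCoeff l η (n + 1)| + |coulombCoeff l η n| := by
        calc ((n : ℝ) + 2) * ((n : ℝ) + 1) * |coulombCoeff l η (n + 2)|
            ≤ ((n : ℝ) + 2) * ((n : ℝ) + 2 + 2 * l + 1) * |coulombCoeff l η (n + 2)| := by
              gcongr
          _ = |((n : ℝ) + 2) * ((n : ℝ) + 2 + 2 * l + 1) * coulombCoeff l η (n + 2)| := by
              rw [abs_mul _ (coulombCoeff l η (n + 2)),
                abs_of_pos (mul_pos (by positivity : (0 : ℝ) < (n : ℝ) + 2) hw)]
          _ ≤ |2 * η * coulombCoeff l η (n + 1)| + |coulombCoeff l η n| := by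
              rw [hrec]; exact abs_sub _ _
          _ = _ := by rw [abs_mul, abs_mul, abs_two]
      have hbound : 2 * |η| * |coulombCoeff l η (n + 1)| + |coulombCoeff l η n| ≤
          C * M ^ (n + 2) / (n.factorial : ℝ) := by
        have hle1 : C * M ^ (n + 1) / ((n + 1).factorial : ℝ) ≤
            C * M ^ (n + 1) / (n.factorial : ℝ) := by
          gcongr
          omega
        calc 2 * |η| * |coulombCoeff l η (n + 1)| + |coulombCoeff l η n|
            ≤ 2 * |η| * (C * M ^ (n + 1) / (n.factorial : ℝ)) +
                C * M ^ n / (n.factorial : ℝ) := by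
              gcongr
              exact ih1.trans hle1
          _ = C * M ^ n * (2 * |η| * M + 1) / (n.factorial : ℝ) := by ring
          _ ≤ C * M ^ n * M ^ 2 / (n.factorial : ℝ) := by
              gcongr
              nlinarith
          _ = _ := by ring
      have hfac2 : ((n + 2).factorial : ℝ) = ((n : ℝ) + 2) * ((n : ℝ) + 1) * n.factorial := by
        rw [Nat.factorial_succ, Nat.factorial_succ]; push_cast; ring
      rw [hfac2, le_div_iff₀ (by positivity)]
      rw [le_div_iff₀ hfac] at hbound
      nlinarith [mul_le_mul_of_nonneg_right habs hfac.le]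

/-- The first derivative of `coulombPhi`. -/
noncomputable def coulombPhiDeriv (l η x : ℝ) : ℝ :=
  ∑' k : ℕ, derivCoeff (coulombCoeff l η) k * x ^ k

/-- The second derivative of `coulombPhi`. -/
noncomputable def coulombPhiDerivTwo (l η x : ℝ) : ℝ :=
  ∑' k : ℕ, derivCoeff (derivCoeff (coulombCoeff l η)) k * x ^ k

theorem hasDerivAt_coulombPhi (l η : ℝ) (hl : -1 < l) (x : ℝ) :
    HasDerivAt (coulombPhi l η) (coulombPhiDeriv l η x) x :=
  hasDerivAt_tsum_mul_pow_of_exp_bound (coulombCoeff_exp_bound l η hl) x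

theorem hasDerivAt_coulombPhiDeriv (l η : ℝ) (hl : -1 < l) (x : ℝ) :
    HasDerivAt (coulombPhiDeriv l η) (coulombPhiDerivTwo l η x) x :=
  hasDerivAt_tsum_mul_pow_of_exp_bound
    (derivCoeff_exp_bound (coulombCoeff_exp_bound l η hl)) x

theorem coulombPhi_zero (l η : ℝ) : coulombPhi l η 0 = 1 := by
  rw [coulombPhi, tsum_eq_single 0 fun k hk => by simp [hk]]
  simp [coulombCoeff]

theorem coulombPhiDeriv_zero (l η : ℝ) : coulombPhiDeriv l η 0 = η / (l + 1) := by
  rw [coulombPhiDeriv, tsum_eq_single 0 fun k hk => by simp [hk]]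
  simp [derivCoeff, coulombCoeff]

/-- The Coulomb differential equation satisfied by `coulombPhi`. -/
theorem coulombPhi_ode (l η : ℝ) (hl : -1 < l) (x : ℝ) :
    x * coulombPhiDerivTwo l η x + 2 * (l + 1) * coulombPhiDeriv l η x +
      (x - 2 * η) * coulombPhi l η x = 0 := by
  have hb := coulombCoeff_exp_bound l η hl
  have s0 := summable_mul_pow_of_exp_bound hb x
  have s1 := summable_mul_pow_of_exp_bound (derivCoeff_exp_bound hb) x
  have s2 := summable_mul_pow_of_exp_bound (derivCoeff_exp_bound (derivCoeff_exp_bound hb)) x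
  have t0 := s0.tsum_eq_zero_add
  have t1 := s1.tsum_eq_zero_add
  have u0 := ((summable_nat_add_iff 1).2 s0).hasSum
  have u1 := ((summable_nat_add_iff 1).2 s1).hasSum
  have hsum := (((s2.hasSum.mul_left x).add (u1.mul_left (2 * (l + 1)))).add
    (s0.hasSum.mul_left x)).sub (u0.mul_left (2 * η))
  have hzero := hsum.unique (HasSum.congr_fun hasSum_zero fun n => ?_)
  · have hl' : l + 1 ≠ 0 := by linarith
    have hconst : (l + 1) * derivCoeff (coulombCoeff l η) 0 = η := by
      simp only [derivCoeff, coulombCoeff, Nat.cast_zero, zero_add]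
      field_simp
    rw [coulombPhiDerivTwo, coulombPhiDeriv, coulombPhi]
    have h0 : coulombCoeff l η 0 = 1 := rfl
    rw [pow_zero, mul_one] at t0 t1
    rw [h0] at t0
    linear_combination hzero + 2 * (l + 1) * t1 - 2 * η * t0 + 2 * hconst
  · have hrec := coulombCoeff_add_two l η hl n
    simp only [derivCoeff]
    push_cast
    linear_combination x ^ (n + 1) * hrec

/-- If `p' = -(L / t) p + s` with `s ≥ 0` on `(0, c)`, then `t ^ L * p t` is nondecreasing, so
positivity of `p` propagates to the right endpoint. -/
theorem pos_at_right_endpoint {p p' : ℝ → ℝ} {L c : ℝ} (hc : 0 < c)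
    (hp : ∀ t, 0 < t → HasDerivAt p (p' t) t)
    (hineq : ∀ t ∈ Ioo 0 c, 0 ≤ L / t * p t + p' t)
    (hpos : ∀ t ∈ Ioo 0 c, 0 < p t) : 0 < p c := by
  have hd : ∀ t, 0 < t →
      HasDerivAt (fun t => t ^ L * p t) (t ^ L * (L / t * p t + p' t)) t := by
    intro t ht
    refine ((Real.hasDerivAt_rpow_const (p := L) (Or.inl ht.ne')).mul (hp t ht)).congr_deriv ?_
    rw [Real.rpow_sub_one ht.ne']
    ring
  have hmono : MonotoneOn (fun t => t ^ L * p t) (Icc (c / 2) c) := by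
    refine monotoneOn_of_deriv_nonneg (convex_Icc _ _) ?_ ?_ ?_
    · exact fun t ht => (hd t (by linarith [ht.1])).continuousAt.continuousWithinAt
    · intro t ht
      rw [interior_Icc] at ht
      exact (hd t (by linarith [ht.1])).differentiableAt.differentiableWithinAt
    · intro t ht
      rw [interior_Icc] at ht
      have ht0 : 0 < t := by linarith [ht.1]
      rw [(hd t ht0).deriv]
      exact mul_nonneg (Real.rpow_nonneg ht0.le _) (hineq t ⟨ht0, ht.2⟩)
  have h1 := hmono (left_mem_Icc.2 (by linarith)) (right_mem_Icc.2 (by linarith))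
    (by linarith : c / 2 ≤ c)
  have h2 := mul_pos (Real.rpow_pos_of_pos (half_pos hc) L)
    (hpos (c / 2) ⟨by linarith, by linarith⟩)
  exact pos_of_mul_pos_right (h2.trans_le h1) (Real.rpow_nonneg hc.le L)

/-- Cooperative pairs stay positive: if `p`, `q` start positive and
`p' = -(L / t) p + α q`, `q' = -(L / t) q + β p` with `α, β ≥ 0` on `(0, x)`, then `p x`
and `q x` are positive. -/
theorem cooperative_pos {p q p' q' α β : ℝ → ℝ} {L x : ℝ} (hx : 0 < x)
    (hp : ∀ t, HasDerivAt p (p' t) t) (hq : ∀ t, HasDerivAt q (q' t) t)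
    (hp0 : 0 < p 0) (hq0 : 0 < q 0)
    (hpe : ∀ t, 0 < t → L / t * p t + p' t = α t * q t)
    (hqe : ∀ t, 0 < t → L / t * q t + q' t = β t * p t)
    (hα : ∀ t ∈ Ioo 0 x, 0 ≤ α t) (hβ : ∀ t ∈ Ioo 0 x, 0 ≤ β t) :
    0 < p x ∧ 0 < q x := by
  by_contra hcon
  have hpc : Continuous p := continuous_iff_continuousAt.2 fun t => (hp t).continuousAt
  have hqc : Continuous q := continuous_iff_continuousAt.2 fun t => (hq t).continuousAt
  have hcomp : IsCompact (Icc 0 x ∩ {t | min (p t) (q t) ≤ 0}) :=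
    isCompact_Icc.inter_right (isClosed_le (hpc.min hqc) continuous_const)
  have hne : (Icc 0 x ∩ {t | min (p t) (q t) ≤ 0}).Nonempty :=
    ⟨x, right_mem_Icc.2 hx.le, not_lt.1 fun h => hcon (lt_min_iff.1 h)⟩
  obtain ⟨c, ⟨hcI, hcm⟩, hleast⟩ := hcomp.exists_isLeast hne
  have hc : 0 < c := by
    refine lt_of_le_of_ne hcI.1 ?_
    rintro rfl
    exact absurd hcm (not_le.2 (lt_min hp0 hq0))
  have hbefore : ∀ t ∈ Ioo 0 c, 0 < p t ∧ 0 < q t := by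
    intro t ht
    refine lt_min_iff.1 (not_le.1 fun h => ?_)
    exact absurd (hleast ⟨⟨ht.1.le, ht.2.le.trans hcI.2⟩, h⟩) (not_le.2 ht.2)
  have hsub : ∀ t ∈ Ioo 0 c, t ∈ Ioo 0 x := fun t ht => ⟨ht.1, ht.2.trans_le hcI.2⟩
  refine absurd (show min (p c) (q c) ≤ 0 from hcm) (not_le.2 (lt_min ?_ ?_))
  · refine pos_at_right_endpoint (L := L) hc (fun t _ => hp t) (fun t ht => ?_)
      fun t ht => (hbefore t ht).1
    rw [hpe t ht.1]
    exact mul_nonneg (hα t (hsub t ht)) (hbefore t ht).2.le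
  · refine pos_at_right_endpoint (L := L) hc (fun t _ => hq t) (fun t ht => ?_)
      fun t ht => (hbefore t ht).2
    rw [hqe t ht.1]
    exact mul_nonneg (hβ t (hsub t ht)) (hbefore t ht).1.le

/-- `coulombPhi` is positive up to and including `η + √(η² + (l+1)²)`. -/
theorem coulombPhi_pos (l η : ℝ) (hl : -1 < l) {x : ℝ} (hx : 0 < x)
    (hxle : x ≤ η + Real.sqrt (η ^ 2 + (l + 1) ^ 2)) : 0 < coulombPhi l η x := by
  set L : ℝ := l + 1 with hL
  have hL0 : 0 < L := by linarith
  set r : ℝ := Real.sqrt (η ^ 2 + L ^ 2)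
  have hr0 : 0 < r := Real.sqrt_pos.2 (by positivity)
  have hr2 : r ^ 2 = η ^ 2 + L ^ 2 := Real.sq_sqrt (by positivity)
  have hrη : |η| < r := Real.lt_sqrt_of_sq_lt (by rw [sq_abs]; nlinarith)
  have hηr := abs_lt.1 hrη
  let f := coulombPhi l η
  let f' := coulombPhiDeriv l η
  let f'' := coulombPhiDerivTwo l η
  -- `g` is a constant multiple of `x * coulombPhi (l + 1) η x`.
  let g : ℝ → ℝ := fun t => (η * f t - L * f' t) / r
  let g' : ℝ → ℝ := fun t => (η * f' t - L * f'' t) / r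
  have hf : ∀ t, HasDerivAt f (f' t) t := hasDerivAt_coulombPhi l η hl
  have hf' : ∀ t, HasDerivAt f' (f'' t) t := hasDerivAt_coulombPhiDeriv l η hl
  have hg : ∀ t, HasDerivAt g (g' t) t := fun t =>
    (((hf t).const_mul η).sub ((hf' t).const_mul L)).div_const r
  have hg0 : g 0 = 0 := by
    simp only [g, f, f', coulombPhi_zero, coulombPhiDeriv_zero, ← hL]
    field_simp
    ring
  have hf0 : f 0 = 1 := coulombPhi_zero l η
  have hode : ∀ t, t * f'' t + 2 * L * f' t + (t - 2 * η) * f t = 0 :=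
    coulombPhi_ode l η hl
  have hrel : ∀ t, L * f' t = η * f t - r * g t := by
    intro t
    simp only [g]
    field_simp
    ring
  have hgrel : ∀ t, 0 < t → g' t = r / L * f t - (η / L + 2 * L / t) * g t := by
    intro t ht
    have e1 : f' t = (η * f t - r * g t) / L := by rw [← hrel t]; field_simp
    have e2 : f'' t = -(2 * L * f' t + (t - 2 * η) * f t) / t := by
      rw [eq_div_iff ht.ne']; linarith [hode t]
    simp only [g']
    rw [e2, e1]
    field_simp
    linear_combination (-t * f t) * hr2
  have hfrel : ∀ t, f' t = (η * f t - r * g t) / L := by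
    intro t
    rw [← hrel t]; field_simp
  have hpos := cooperative_pos (p := fun t => f t - g t) (q := fun t => f t + g t)
    (p' := fun t => f' t - g' t) (q' := fun t => f' t + g' t)
    (α := fun t => L / t + η / L - r / L) (β := fun t => L / t + η / L + r / L) (L := L) hx
    (fun t => (hf t).sub (hg t)) (fun t => (hf t).add (hg t))
    (by simp [hf0, hg0]) (by simp [hf0, hg0])
    (fun t ht => by
      rw [hgrel t ht, hfrel t]
      field_simp
      ring)
    (fun t ht => by
      rw [hgrel t ht, hfrel t]
      field_simp
      ring)
    (fun t ht => by
      have ht0 : 0 < t := ht.1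
      have : L / t + η / L - r / L = (L ^ 2 - (r - η) * t) / (t * L) := by field_simp; ring
      rw [this]
      refine div_nonneg ?_ (by positivity)
      nlinarith [mul_nonneg (sub_nonneg.2 (ht.2.le.trans hxle)) (sub_pos.2 hηr.2).le])
    (fun t ht => by
      have ht0 : 0 < t := ht.1
      have : L / t + η / L + r / L = L / t + (η + r) / L := by ring
      rw [this]
      have : 0 < η + r := by linarith
      positivity)
  have h1 : 0 < f x - g x := hpos.1
  have h2 : 0 < f x + g x := hpos.2
  change 0 < f x
  linarith

/-- Corollary 5.1: for η ≠ 0 and ℓ > −1, every positive zero of F_{ℓ,η} (equivalently of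
φ_{ℓ,η}) is strictly greater than η + √(η² + (ℓ+1)²), which is positive. -/
theorem stmt_18 (l η : ℝ) (hl : -1 < l) (hη : η ≠ 0) :
    ∀ x : ℝ, 0 < x → coulombPhi l η x = 0 →
      x > η + Real.sqrt (η ^ 2 + (l + 1) ^ 2) ∧ η + Real.sqrt (η ^ 2 + (l + 1) ^ 2) > 0 := by
  intro x hx hzero
  refine ⟨not_le.1 fun hle => (coulombPhi_pos l η hl hx hle).ne' hzero, ?_⟩
  have hlt : |η| < Real.sqrt (η ^ 2 + (l + 1) ^ 2) :=
    Real.lt_sqrt_of_sq_lt (by rw [sq_abs]; nlinarith)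
  linarith [(abs_lt.1 hlt).1]
end
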